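/- Fix a prime g ≥ 5. For every ε > 0 there exists a constant C = C(g, ε) such that for all real X ≥ 2 and all real Z with X^{1/(2g)} ≤ Z ≤ X, the sum of S_g(d;Z)² over squarefree integers d with X ≤ d < 2X is at most C · X^ε · ( Z² X^{1/2} + Z^{2g+4} X^{-1} ). -/

import Mathlib

/-- `Sg g d Z` is the number of ordered pairs `(p, p')` of distinct primes with
`Z ≤ p, p' < 2Z` for which there exist nonzero integers `u, v` with
`gcd(v, p·p') = 1` and `4(p·p')^g = u² + d·v²`. -/
noncomputable def Sg (g d : ℕ) (Z : ℝ) : ℕ :=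
  Nat.card {pq : ℕ × ℕ // pq.1.Prime ∧ pq.2.Prime ∧ pq.1 ≠ pq.2 ∧
    Z ≤ pq.1 ∧ (pq.1 : ℝ) < 2 * Z ∧ Z ≤ pq.2 ∧ (pq.2 : ℝ) < 2 * Z ∧
    ∃ u v : ℤ, u ≠ 0 ∧ v ≠ 0 ∧ Int.gcd v ((pq.1 : ℤ) * pq.2) = 1 ∧
      4 * ((pq.1 : ℤ) * pq.2) ^ g = u ^ 2 + (d : ℤ) * v ^ 2}

/-- The divisor bound: `τ(n) ≪ n ^ δ` for every `δ > 0`. -/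
lemma exists_card_divisors_le_rpow {δ : ℝ} (hδ : 0 < δ) :
    ∃ K : ℝ, 0 < K ∧ ∀ n : ℕ, n ≠ 0 → (n.divisors.card : ℝ) ≤ K * (n : ℝ) ^ δ := by
  set k : ℝ := 1 + 2 / δ with hk
  have hk1 : 1 ≤ k := by
    have : 0 < 2 / δ := by positivity
    linarith
  set P : ℕ := ⌈(2 : ℝ) ^ (1 / δ)⌉₊ with hP
  refine ⟨k ^ P, by positivity, fun n hn => ?_⟩
  have key : ∀ p ∈ n.primeFactors, ((n.factorization p + 1 : ℕ) : ℝ) ≤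
      (if p < P then k else 1) * ((p : ℝ) ^ n.factorization p) ^ δ := by
    intro p hp
    have hp2 : (2 : ℝ) ≤ p := by exact_mod_cast (Nat.prime_of_mem_primeFactors hp).two_le
    generalize n.factorization p = a
    split_ifs with h
    · have h1 : ((2 : ℝ) ^ a) ^ δ ≤ ((p : ℝ) ^ a) ^ δ := by gcongr
      have h2 : 1 + a * δ / 2 ≤ ((2 : ℝ) ^ a) ^ δ := by
        rw [← Real.rpow_natCast, ← Real.rpow_mul (by norm_num), Real.rpow_def_of_pos (by norm_num)]
        have := Real.add_one_le_exp (Real.log 2 * (a * δ))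
        have h3 := Real.log_two_gt_d9
        have h4 : (0 : ℝ) ≤ a * δ := by positivity
        nlinarith
      have h3 : ((a + 1 : ℕ) : ℝ) ≤ k * (1 + a * δ / 2) := by
        have : k * (1 + a * δ / 2) = 1 + a + 2 / δ + a * δ / 2 := by
          rw [hk]; field_simp; ring
        rw [this]; push_cast
        have : 0 ≤ 2 / δ + a * δ / 2 := by positivity
        linarith
      calc _ ≤ _ := h3
        _ ≤ _ := by gcongr; exact h2.trans h1
    · have h1 : (2 : ℝ) ^ (1 / δ) ≤ p := (Nat.le_ceil _).trans (by exact_mod_cast not_lt.1 h)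
      have h2 : (2 : ℝ) ≤ (p : ℝ) ^ δ := by
        calc (2 : ℝ) = ((2 : ℝ) ^ (1 / δ)) ^ δ := by
              rw [← Real.rpow_mul (by norm_num), one_div_mul_cancel hδ.ne', Real.rpow_one]
          _ ≤ _ := by gcongr
      rw [one_mul, ← Real.rpow_natCast, ← Real.rpow_mul (by positivity), mul_comm,
        Real.rpow_mul (by positivity), Real.rpow_natCast]
      calc ((a + 1 : ℕ) : ℝ) ≤ (2 : ℝ) ^ a := by exact_mod_cast Nat.lt_two_pow_self
        _ ≤ _ := by gcongr
  have hprod : (n : ℝ) ^ δ = ∏ p ∈ n.primeFactors, ((p : ℝ) ^ n.factorization p) ^ δ := by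
    rw [Real.finsetProd_rpow _ _ (fun _ _ => by positivity)]
    congr 1
    conv_lhs => rw [← Nat.prod_factorization_pow_eq_self hn]
    simp [Finsupp.prod]
  rw [Nat.card_divisors hn, hprod, Nat.cast_prod]
  refine (Finset.prod_le_prod (fun _ _ => by positivity) key).trans ?_
  rw [Finset.prod_mul_distrib]
  refine mul_le_mul_of_nonneg_right ?_ (Finset.prod_nonneg fun _ _ => by positivity)
  rw [Finset.prod_ite, Finset.prod_const, Finset.prod_const_one, mul_one]
  refine pow_le_pow_right₀ hk1 ?_
  calc _ ≤ (Finset.range P).card := Finset.card_le_card fun p hp => by simp_all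
    _ = P := Finset.card_range P

open Classical in
/-- A second moment bound by double counting, splitting the pairs `(a, b)` according to
whether they share the value of `key`. -/
lemma sum_sq_card_filter_le {ι α : Type*} (D : Finset ι) (T : Finset α) (R : ι → α → Prop)
    (key : α → ℕ) (c : ℕ) {A B : ℝ} (hA0 : 0 ≤ A) (hB0 : 0 ≤ B)
    (hc : ∀ a ∈ T, (T.filter fun b => key a = key b).card ≤ c)
    (hA : ∀ a ∈ T, ((D.filter fun d => R d a).card : ℝ) ≤ A)
    (hB : ∀ a ∈ T, ∀ b ∈ T, key a ≠ key b →
      ((D.filter fun d => R d a ∧ R d b).card : ℝ) ≤ B) :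
    ∑ d ∈ D, ((T.filter fun a => R d a).card : ℝ) ^ 2 ≤
      c * T.card * A + (T.card : ℝ) ^ 2 * B := by
  have h1 : ∑ d ∈ D, ((T.filter fun a => R d a).card : ℝ) ^ 2 =
      ∑ a ∈ T, ∑ b ∈ T, ((D.filter fun d => R d a ∧ R d b).card : ℝ) := by
    simp only [Finset.card_filter, Nat.cast_sum, sq, Finset.sum_mul_sum]
    rw [Finset.sum_comm]
    refine Finset.sum_congr rfl fun a _ => ?_
    rw [Finset.sum_comm]
    refine Finset.sum_congr rfl fun b _ => Finset.sum_congr rfl fun d _ => ?_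
    by_cases h : R d a <;> by_cases h' : R d b <;> simp [h, h']
  rw [h1]
  calc _ ≤ ∑ a ∈ T, (c * A + T.card * B) := by
        refine Finset.sum_le_sum fun a ha => ?_
        calc _ ≤ ∑ b ∈ T, ((if key a = key b then A else 0) + B) := by
              refine Finset.sum_le_sum fun b hb => ?_
              split_ifs with h
              · refine le_add_of_le_of_nonneg (le_trans ?_ (hA a ha)) hB0
                exact_mod_cast Finset.card_le_card fun d hd => by simp_all
              · rw [zero_add]; exact hB a ha b hb h
          _ = (T.filter fun b => key a = key b).card * A + T.card * B := by
              rw [Finset.sum_add_distrib, ← Finset.sum_filter]; simp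
          _ ≤ _ := by gcongr; exact hc a ha
    _ = _ := by simp; ring

/-- A set of integers lying in one residue class modulo `k` and of diameter at most `L`
has at most `L / k + 1` elements. -/
lemma card_le_of_dvd_sub {S : Finset ℕ} {k : ℕ} {L : ℝ} (hk : 0 < k) (hL : 0 ≤ L)
    (hmod : ∀ u ∈ S, ∀ w ∈ S, (k : ℤ) ∣ (w : ℤ) - u)
    (hdiam : ∀ u ∈ S, ∀ w ∈ S, u ≤ w → (w : ℝ) - u ≤ L) :
    (S.card : ℝ) ≤ L / k + 1 := by
  rcases S.eq_empty_or_nonempty with rfl | hS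
  · simp; positivity
  set m := S.min' hS
  have hm : m ∈ S := S.min'_mem hS
  have hdiv : ∀ u ∈ S, ∃ q : ℕ, u = m + k * q := by
    intro u hu
    have hmu : m ≤ u := S.min'_le u hu
    have := hmod m hm u hu
    rw [← Nat.cast_sub hmu] at this
    obtain ⟨q, hq⟩ := Int.natCast_dvd_natCast.1 this
    exact ⟨q, by omega⟩
  choose! q hq using hdiv
  have hcard : S.card ≤ (Finset.range (⌊L / k⌋₊ + 1)).card := by
    refine Finset.card_le_card_of_injOn q (fun u hu => ?_) (fun u hu w hw h => ?_)
    · simp only [Finset.coe_range, Set.mem_Iio, Nat.lt_succ_iff]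
      refine Nat.le_floor ?_
      rw [le_div_iff₀ (by positivity)]
      have h1 := hdiam m hm u hu (S.min'_le u hu)
      have h2 : (u : ℝ) = m + k * q u := by exact_mod_cast hq u hu
      linarith
    · rw [hq u hu, hq w hw, h]
  rw [Finset.card_range] at hcard
  have h1 : (S.card : ℝ) ≤ ⌊L / k⌋₊ + 1 := by exact_mod_cast hcard
  have h2 := Nat.floor_le (show 0 ≤ L / k by positivity)
  linarith

/-- `d` is represented by `m`: `4 m ^ g = u ^ 2 + d v ^ 2` with `u, v` positive and `v`
coprime to `m`. -/
def IsRepBy (g d m : ℕ) : Prop :=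
  ∃ u v : ℕ, 0 < u ∧ 0 < v ∧ v.Coprime m ∧ 4 * m ^ g = u ^ 2 + d * v ^ 2

/-- For fixed `v`, the integers `u` with `4 m ^ g = u ^ 2 + d v ^ 2` and `X ≤ d < 2X` lie close
together, and in few residue classes modulo divisors of `v ^ 2` of size at least `v ^ 2 / 4`. -/
lemma card_le_of_forall_eq_sq_add {g m v : ℕ} {X y : ℝ} {S : Finset ℕ} (hv : 0 < v)
    (hvm : v.Coprime m) (hX : 0 ≤ X) (hy : 0 < y) (hym : y ^ 2 ≤ (m : ℝ) ^ g)
    (hS : ∀ u ∈ S, ∃ d : ℕ, 4 * m ^ g = u ^ 2 + d * v ^ 2 ∧ X ≤ d ∧ (d : ℝ) < 2 * X) :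
    (S.card : ℝ) ≤ (v ^ 2).divisors.card * (8 * X / y + 1) := by
  have hdiam : ∀ u ∈ S, ∀ w ∈ S, u ≤ w → (w : ℝ) - u ≤ 2 * X * v ^ 2 / y := by
    intro u hu w hw huw
    obtain ⟨d, hd, hd1, hd2⟩ := hS u hu
    obtain ⟨e, he, he1, he2⟩ := hS w hw
    have hd' : 4 * (m : ℝ) ^ g = (u : ℝ) ^ 2 + d * (v : ℝ) ^ 2 := by exact_mod_cast hd
    have he' : 4 * (m : ℝ) ^ g = (w : ℝ) ^ 2 + e * (v : ℝ) ^ 2 := by exact_mod_cast he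
    have huw' : (u : ℝ) ≤ w := by exact_mod_cast huw
    have hu0 : (0 : ℝ) ≤ u := by positivity
    have hv0 : (0 : ℝ) < (v : ℝ) ^ 2 := by positivity
    have hdv : (d : ℝ) * v ^ 2 ≤ 2 * X * v ^ 2 := by gcongr
    have hev : X * v ^ 2 ≤ (e : ℝ) * v ^ 2 := by gcongr
    rw [le_div_iff₀ hy]
    rcases le_or_gt (y / 2) w with h | h
    · nlinarith [mul_nonneg (sub_nonneg.2 huw') (sub_nonneg.2 h), mul_nonneg (sub_nonneg.2 huw') hu0]
    · nlinarith
  rcases S.eq_empty_or_nonempty with rfl | ⟨u₀, hu₀⟩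
  · simp; positivity
  obtain ⟨d₀, hd₀, -, -⟩ := hS u₀ hu₀
  have hgcd : Nat.gcd v u₀ ∣ 2 := by
    have h1 : (Nat.gcd v u₀) ^ 2 ∣ 4 * m ^ g := by
      rw [hd₀]
      exact dvd_add (pow_dvd_pow_of_dvd (Nat.gcd_dvd_right _ _) 2)
        (Dvd.dvd.mul_left (pow_dvd_pow_of_dvd (Nat.gcd_dvd_left _ _) 2) _)
    have h2 : Nat.Coprime (Nat.gcd v u₀ ^ 2) (m ^ g) :=
      Nat.Coprime.pow _ _ (hvm.coprime_dvd_left (Nat.gcd_dvd_left _ _))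
    exact (Nat.pow_dvd_pow_iff two_ne_zero).1 (h2.dvd_of_dvd_mul_right h1 : _ ∣ 2 ^ 2)
  set U : ℕ → Finset ℕ := fun e => S.filter fun u =>
    (e : ℤ) ∣ (u : ℤ) - u₀ ∧ ((v ^ 2 / e : ℕ) : ℤ) ∣ (u : ℤ) + u₀ with hU
  have hcover : S ⊆ (v ^ 2).divisors.biUnion U := by
    intro u hu
    obtain ⟨d, hd, -, -⟩ := hS u hu
    have h1 : (v : ℤ) ^ 2 ∣ ((u : ℤ) - u₀) * ((u : ℤ) + u₀) := by
      refine ⟨(d₀ : ℤ) - d, ?_⟩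
      have : (u : ℤ) ^ 2 + d * v ^ 2 = u₀ ^ 2 + d₀ * v ^ 2 := by exact_mod_cast hd.symm.trans hd₀
      linear_combination this
    have h2 : v ^ 2 ∣ ((u : ℤ) - u₀).natAbs * ((u : ℤ) + u₀).natAbs := by
      rw [← Int.natAbs_mul, ← Int.natCast_dvd]; exact_mod_cast h1
    obtain ⟨e, f, he, hf, hef⟩ := exists_dvd_and_dvd_of_dvd_mul h2
    have he0 : 0 < e := Nat.pos_of_ne_zero (by rintro rfl; simp [hv.ne'] at hef)
    rw [Finset.mem_biUnion]
    refine ⟨e, Nat.mem_divisors.2 ⟨⟨f, hef⟩, by positivity⟩, ?_⟩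
    rw [hU, Finset.mem_filter, hef, Nat.mul_div_cancel_left _ he0]
    exact ⟨hu, Int.natCast_dvd.2 he, Int.natCast_dvd.2 hf⟩
  have hUcard : ∀ e ∈ (v ^ 2).divisors, ((U e).card : ℝ) ≤ 8 * X / y + 1 := by
    intro e he
    obtain ⟨f, hf⟩ := (Nat.mem_divisors.1 he).1
    have hv2 : 0 < v ^ 2 := by positivity
    have he0 : 0 < e := Nat.pos_of_ne_zero (by rintro rfl; simp at hf; omega)
    have hf0 : 0 < f := Nat.pos_of_ne_zero (by rintro rfl; simp at hf; omega)
    have hfe : v ^ 2 / e = f := by rw [hf, Nat.mul_div_cancel_left _ he0]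
    rcases (U e).eq_empty_or_nonempty with h | ⟨u, hu⟩
    · rw [h]; simp; positivity
    have hU' : ∀ w ∈ U e, w ∈ S ∧ (e : ℤ) ∣ (w : ℤ) - u₀ ∧ (f : ℤ) ∣ (w : ℤ) + u₀ := by
      intro w hw; rw [hU, Finset.mem_filter, hfe] at hw; exact hw
    have hlcm : 0 < Nat.lcm e f := Nat.lcm_pos he0 hf0
    have h4 : Nat.gcd e f ∣ 4 := by
      obtain ⟨-, hu1, hu2⟩ := hU' u hu
      have h1 : Nat.gcd e f ∣ 2 * u₀ := by
        have h1 : ((Nat.gcd e f : ℕ) : ℤ) ∣ (u : ℤ) - u₀ :=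
          (Int.natCast_dvd_natCast.2 (Nat.gcd_dvd_left e f)).trans hu1
        have h2 : ((Nat.gcd e f : ℕ) : ℤ) ∣ (u : ℤ) + u₀ :=
          (Int.natCast_dvd_natCast.2 (Nat.gcd_dvd_right e f)).trans hu2
        have h3 := dvd_sub h2 h1
        rw [← Int.natCast_dvd_natCast]
        push_cast
        rwa [show (u : ℤ) + u₀ - (u - u₀) = 2 * u₀ by ring] at h3
      have h2 : Nat.gcd e f ∣ v := by
        rw [← Nat.pow_dvd_pow_iff two_ne_zero, hf, sq]
        exact mul_dvd_mul (Nat.gcd_dvd_left e f) (Nat.gcd_dvd_right e f)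
      calc Nat.gcd e f ∣ Nat.gcd (2 * v) (2 * u₀) := Nat.dvd_gcd (h2.mul_left 2) h1
        _ = 2 * Nat.gcd v u₀ := Nat.gcd_mul_left _ _ _
        _ ∣ 2 * 2 := mul_dvd_mul_left 2 hgcd
    have hk : (v : ℝ) ^ 2 ≤ 4 * (Nat.lcm e f : ℕ) := by
      have h1 := Nat.gcd_mul_lcm e f
      have h2 : Nat.gcd e f ≤ 4 := Nat.le_of_dvd (by norm_num) h4
      have h3 : v ^ 2 ≤ 4 * Nat.lcm e f := by
        rw [hf, ← h1]; gcongr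
      exact_mod_cast h3
    refine (card_le_of_dvd_sub (L := 2 * X * v ^ 2 / y) hlcm (by positivity) ?_ ?_).trans ?_
    · intro a ha b hb
      obtain ⟨-, ha1, ha2⟩ := hU' a ha
      obtain ⟨-, hb1, hb2⟩ := hU' b hb
      rw [Int.natCast_dvd]
      refine Nat.lcm_dvd (Int.natCast_dvd.1 ?_) (Int.natCast_dvd.1 ?_)
      · simpa using dvd_sub hb1 ha1
      · simpa using dvd_sub hb2 ha2
    · exact fun a ha b hb => hdiam a (hU' a ha).1 b (hU' b hb).1
    · refine add_le_add_left ?_ 1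
      have : (0 : ℝ) < (Nat.lcm e f : ℕ) := by exact_mod_cast hlcm
      rw [div_div, div_le_div_iff₀ (by positivity) hy]
      have h5 : 0 ≤ 2 * X * y := by positivity
      nlinarith [mul_le_mul_of_nonneg_left hk h5]
  calc (S.card : ℝ) ≤ ((v ^ 2).divisors.biUnion U).card := by
        exact_mod_cast Finset.card_le_card hcover
    _ ≤ ∑ e ∈ (v ^ 2).divisors, ((U e).card : ℝ) := by exact_mod_cast Finset.card_biUnion_le
    _ ≤ ∑ e ∈ (v ^ 2).divisors, (8 * X / y + 1) := Finset.sum_le_sum hUcard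
    _ = _ := by rw [Finset.sum_const, nsmul_eq_mul]

/-- In `4 m ^ g = u ^ 2 + d v ^ 2` with `d ≥ X`, the variable `v` is bounded. -/
lemma le_floor_of_eq_sq_add {g m u v d : ℕ} {X V : ℝ} (hX : 0 < X) (hV : 0 ≤ V) (hd : X ≤ d)
    (hm : 4 * (m : ℝ) ^ g ≤ X * V ^ 2) (h : 4 * m ^ g = u ^ 2 + d * v ^ 2) : v ≤ ⌊V⌋₊ := by
  refine Nat.le_floor ?_
  have h' : 4 * (m : ℝ) ^ g = (u : ℝ) ^ 2 + d * (v : ℝ) ^ 2 := by exact_mod_cast h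
  have h1 : X * (v : ℝ) ^ 2 ≤ d * (v : ℝ) ^ 2 := by gcongr
  have h2 : X * (v : ℝ) ^ 2 ≤ X * V ^ 2 := by nlinarith [sq_nonneg (u : ℝ)]
  exact (pow_le_pow_iff_left₀ (by positivity) hV two_ne_zero).1 (le_of_mul_le_mul_left h2 hX)

open Classical in
/-- First moment: the number of `d ∈ [X, 2X)` represented by a given `m`. -/
lemma card_filter_isRepBy_le {g m : ℕ} {X V y B : ℝ} {D : Finset ℕ}
    (hX : 0 < X) (hV : 0 ≤ V) (hy : 0 < y) (hB0 : 0 ≤ B) (hym : y ^ 2 ≤ (m : ℝ) ^ g)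
    (hm : 4 * (m : ℝ) ^ g ≤ X * V ^ 2) (hD : ∀ d ∈ D, X ≤ d ∧ (d : ℝ) < 2 * X)
    (hB : ∀ n : ℕ, n ≠ 0 → (n : ℝ) ≤ V ^ 2 → (n.divisors.card : ℝ) ≤ B) :
    ((D.filter fun d => IsRepBy g d m).card : ℝ) ≤ V * (B * (8 * X / y + 1)) := by
  set E : ℕ → Finset ℕ := fun v =>
    D.filter fun d => v.Coprime m ∧ ∃ u : ℕ, 4 * m ^ g = u ^ 2 + d * v ^ 2 with hE
  have hcover : (D.filter fun d => IsRepBy g d m) ⊆ (Finset.Icc 1 ⌊V⌋₊).biUnion E := by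
    intro d hd
    obtain ⟨hdD, u, v, -, hv, hvm, h⟩ := Finset.mem_filter.1 hd
    exact Finset.mem_biUnion.2 ⟨v, Finset.mem_Icc.2
      ⟨hv, le_floor_of_eq_sq_add hX hV (hD d hdD).1 hm h⟩, Finset.mem_filter.2 ⟨hdD, hvm, u, h⟩⟩
  have hcard : ∀ v ∈ Finset.Icc 1 ⌊V⌋₊, ((E v).card : ℝ) ≤ B * (8 * X / y + 1) := by
    intro v hv
    obtain ⟨hv1, hv2⟩ := Finset.mem_Icc.1 hv
    have hE' : ∀ d ∈ E v, d ∈ D ∧ v.Coprime m ∧ ∃ u : ℕ, 4 * m ^ g = u ^ 2 + d * v ^ 2 :=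
      fun d hd => Finset.mem_filter.1 hd
    rcases (E v).eq_empty_or_nonempty with h | ⟨d₁, hd₁⟩
    · rw [h]; simp; positivity
    choose! u hu using fun d hd => (hE' d hd).2.2
    have hinj : Set.InjOn u (E v) := by
      intro a ha b hb hab
      have h1 := (hu a ha).symm.trans (hu b hb)
      rw [hab, Nat.add_left_cancel_iff] at h1
      exact Nat.eq_of_mul_eq_mul_right (by positivity) h1
    rw [← Finset.card_image_of_injOn hinj]
    refine (card_le_of_forall_eq_sq_add (X := X) hv1 (hE' d₁ hd₁).2.1 hX.le hy hym ?_).trans ?_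
    · intro w hw
      obtain ⟨d, hd, rfl⟩ := Finset.mem_image.1 hw
      exact ⟨d, hu d hd, hD d (hE' d hd).1⟩
    · gcongr
      refine hB _ (by positivity) ?_
      push_cast
      gcongr
      exact (Nat.le_floor_iff hV).1 hv2
  calc _ ≤ (((Finset.Icc 1 ⌊V⌋₊).biUnion E).card : ℝ) := by
        exact_mod_cast Finset.card_le_card hcover
    _ ≤ ∑ v ∈ Finset.Icc 1 ⌊V⌋₊, ((E v).card : ℝ) := by exact_mod_cast Finset.card_biUnion_le
    _ ≤ ∑ v ∈ Finset.Icc 1 ⌊V⌋₊, B * (8 * X / y + 1) := Finset.sum_le_sum hcard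
    _ = ⌊V⌋₊ * (B * (8 * X / y + 1)) := by simp
    _ ≤ _ := by gcongr; exact Nat.floor_le hV

/-- For odd `g` and distinct squarefree `m, n`, the quotient of `m ^ g` by `n ^ g` is not a
rational square. -/
lemma eq_of_squarefree_of_pow_mul_sq_eq {g m n v z : ℕ} (hg : Odd g) (hm : Squarefree m)
    (hn : Squarefree n) (hv : v ≠ 0) (hz : z ≠ 0) (h : m ^ g * v ^ 2 = n ^ g * z ^ 2) :
    m = n := by
  obtain ⟨k, rfl⟩ := hg
  refine Nat.eq_of_factorization_eq hm.ne_zero hn.ne_zero fun p => ?_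
  have h1 := congrArg (fun x => Nat.factorization x p) h
  simp only [Nat.factorization_mul (pow_ne_zero _ hm.ne_zero) (pow_ne_zero 2 hv),
    Nat.factorization_mul (pow_ne_zero _ hn.ne_zero) (pow_ne_zero 2 hz),
    Nat.factorization_pow, Finsupp.add_apply, Finsupp.smul_apply, smul_eq_mul] at h1
  have h2 := hm.natFactorization_le_one p
  have h3 := hn.natFactorization_le_one p
  generalize m.factorization p = a at *
  generalize n.factorization p = b at *
  interval_cases a <;> interval_cases b <;> omega

open Classical in
/-- For `m ≠ n`, the equations `4 m ^ g = u ^ 2 + d v ^ 2` and `4 n ^ g = w ^ 2 + d z ^ 2` give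
`(w v - u z) (w v + u z) = 4 (n ^ g v ^ 2 - m ^ g z ^ 2) ≠ 0`, so that few `d` satisfy both. -/
lemma card_filter_isRepBy_and_le {g m n : ℕ} {X V M B : ℝ} {D : Finset ℕ} (hg : Odd g)
    (hmsq : Squarefree m) (hnsq : Squarefree n) (hmn : m ≠ n)
    (hX : 0 < X) (hV : 0 ≤ V) (hB0 : 0 ≤ B)
    (hmM : 4 * (m : ℝ) ^ g ≤ M) (hnM : 4 * (n : ℝ) ^ g ≤ M) (hM : M ≤ X * V ^ 2)
    (hD : ∀ d ∈ D, X ≤ d)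
    (hB : ∀ k : ℕ, k ≠ 0 → (k : ℝ) ≤ M * V ^ 2 → (k.divisors.card : ℝ) ≤ B) :
    ((D.filter fun d => IsRepBy g d m ∧ IsRepBy g d n).card : ℝ) ≤ V ^ 2 * B := by
  have hM0 : 0 ≤ M := le_trans (by positivity) hmM
  set E : ℕ × ℕ → Finset ℕ := fun q => D.filter fun d => ∃ u w : ℕ, 0 < u ∧
    4 * m ^ g = u ^ 2 + d * q.1 ^ 2 ∧ 4 * n ^ g = w ^ 2 + d * q.2 ^ 2 with hE
  set Q := Finset.Icc 1 ⌊V⌋₊ ×ˢ Finset.Icc 1 ⌊V⌋₊ with hQ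
  have hcover : (D.filter fun d => IsRepBy g d m ∧ IsRepBy g d n) ⊆ Q.biUnion E := by
    intro d hd
    obtain ⟨hdD, ⟨u, v, hu, hv, -, h⟩, ⟨w, z, -, hz, -, h'⟩⟩ := Finset.mem_filter.1 hd
    exact Finset.mem_biUnion.2 ⟨(v, z), Finset.mem_product.2 ⟨Finset.mem_Icc.2
      ⟨hv, le_floor_of_eq_sq_add hX hV (hD d hdD) (hmM.trans hM) h⟩, Finset.mem_Icc.2
      ⟨hz, le_floor_of_eq_sq_add hX hV (hD d hdD) (hnM.trans hM) h'⟩⟩,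
      Finset.mem_filter.2 ⟨hdD, u, w, hu, h, h'⟩⟩
  have hcard : ∀ q ∈ Q, ((E q).card : ℝ) ≤ B := by
    rintro ⟨v, z⟩ hq
    simp only [hQ, Finset.mem_product, Finset.mem_Icc, Nat.le_floor_iff hV] at hq
    obtain ⟨⟨hv1, hv2⟩, ⟨hz1, hz2⟩⟩ := hq
    have hv0 : v ≠ 0 := by omega
    have hz0 : z ≠ 0 := by omega
    set N : ℤ := 4 * n ^ g * v ^ 2 - 4 * m ^ g * z ^ 2 with hN
    have hN0 : N ≠ 0 := by
      intro h
      refine hmn (eq_of_squarefree_of_pow_mul_sq_eq hg hnsq hmsq hv0 hz0 ?_).symm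
      have : (n : ℤ) ^ g * v ^ 2 = m ^ g * z ^ 2 := by linarith
      exact_mod_cast this
    have hNle : (N.natAbs : ℝ) ≤ M * V ^ 2 := by
      rw [Nat.cast_natAbs, Int.cast_abs, hN]
      push_cast
      have h1 : 4 * (n : ℝ) ^ g * (v : ℝ) ^ 2 ≤ M * V ^ 2 := by gcongr
      have h2 : 4 * (m : ℝ) ^ g * (z : ℝ) ^ 2 ≤ M * V ^ 2 := by gcongr
      have h3 : 0 ≤ 4 * (n : ℝ) ^ g * (v : ℝ) ^ 2 := by positivity
      have h4 : 0 ≤ 4 * (m : ℝ) ^ g * (z : ℝ) ^ 2 := by positivity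
      rw [abs_le]; constructor <;> linarith
    refine le_trans ?_ (hB N.natAbs (Int.natAbs_ne_zero.2 hN0) hNle)
    choose! u w hu h h' using fun d (hd : d ∈ E (v, z)) => (Finset.mem_filter.1 hd).2
    have hfac : ∀ d ∈ E (v, z),
        ((w d : ℤ) * v + u d * z) * ((w d : ℤ) * v - u d * z) = N := by
      intro d hd
      have h1 : 4 * (m : ℤ) ^ g = u d ^ 2 + d * v ^ 2 := by exact_mod_cast h d hd
      have h2 : 4 * (n : ℤ) ^ g = w d ^ 2 + d * z ^ 2 := by exact_mod_cast h' d hd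
      rw [hN, h1, h2]; ring
    have hle : (E (v, z)).card ≤ N.natAbs.divisors.card := by
      refine Finset.card_le_card_of_injOn (fun d => w d * v + u d * z) ?_ ?_
      · intro d hd
        refine Nat.mem_divisors.2 ⟨Int.natCast_dvd.1 ⟨(w d : ℤ) * v - u d * z, ?_⟩, Int.natAbs_ne_zero.2 hN0⟩
        rw [← hfac d hd]; push_cast; rfl
      · intro a ha b hb hab
        have hab' : (w a : ℤ) * v + u a * z = (w b : ℤ) * v + u b * z := by exact_mod_cast hab
        have ha0 : (w b : ℤ) * v + u b * z ≠ 0 := by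
          have := hu b hb
          positivity
        have h1 := (hfac a ha).trans (hfac b hb).symm
        rw [hab'] at h1
        have h2 := mul_left_cancel₀ ha0 h1
        have h3 : (u a : ℤ) * z = u b * z := by linarith
        have h4 : u a = u b := Nat.eq_of_mul_eq_mul_right hz1 (by exact_mod_cast h3)
        have h5 := (h a ha).symm.trans (h b hb)
        rw [h4, Nat.add_left_cancel_iff] at h5
        exact Nat.eq_of_mul_eq_mul_right (by positivity) h5
    exact_mod_cast hle
  calc _ ≤ ((Q.biUnion E).card : ℝ) := by exact_mod_cast Finset.card_le_card hcover
    _ ≤ ∑ q ∈ Q, ((E q).card : ℝ) := by exact_mod_cast Finset.card_biUnion_le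
    _ ≤ ∑ q ∈ Q, B := Finset.sum_le_sum hcard
    _ = (⌊V⌋₊ : ℝ) ^ 2 * B := by simp [hQ, sq]
    _ ≤ _ := by gcongr; exact Nat.floor_le hV

open Classical in
/-- The ordered pairs of distinct primes in `[Z, 2Z)`. -/
noncomputable def primePairs (Z : ℝ) : Finset (ℕ × ℕ) :=
  (Finset.Ico ⌈Z⌉₊ ⌈2 * Z⌉₊ ×ˢ Finset.Ico ⌈Z⌉₊ ⌈2 * Z⌉₊).filter
    fun a => a.1.Prime ∧ a.2.Prime ∧ a.1 ≠ a.2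

lemma mem_primePairs {Z : ℝ} {a : ℕ × ℕ} : a ∈ primePairs Z ↔
    ((Z ≤ a.1 ∧ (a.1 : ℝ) < 2 * Z) ∧ Z ≤ a.2 ∧ (a.2 : ℝ) < 2 * Z) ∧
      a.1.Prime ∧ a.2.Prime ∧ a.1 ≠ a.2 := by
  simp [primePairs, Nat.lt_ceil]

lemma card_primePairs_le {Z : ℝ} (hZ : 1 ≤ Z) : ((primePairs Z).card : ℝ) ≤ 4 * Z ^ 2 := by
  have h1 : ((⌈2 * Z⌉₊ - ⌈Z⌉₊ : ℕ) : ℝ) ≤ 2 * Z := by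
    rw [Nat.cast_sub (Nat.ceil_mono (by linarith))]
    have := Nat.ceil_lt_add_one (show 0 ≤ 2 * Z by linarith)
    have := Nat.le_ceil Z
    linarith
  calc ((primePairs Z).card : ℝ) ≤ ((⌈2 * Z⌉₊ - ⌈Z⌉₊ : ℕ) : ℝ) * ((⌈2 * Z⌉₊ - ⌈Z⌉₊ : ℕ) : ℝ) := by
        rw [← Nat.cast_mul]
        refine Nat.cast_le.2 ((Finset.card_filter_le _ _).trans ?_)
        simp
    _ ≤ (2 * Z) * (2 * Z) := by gcongr
    _ = _ := by ring

lemma card_filter_mul_eq_le (Z : ℝ) {a : ℕ × ℕ} (ha : a ∈ primePairs Z) :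
    ((primePairs Z).filter fun b => a.1 * a.2 = b.1 * b.2).card ≤ 2 := by
  obtain ⟨-, hp, hq, -⟩ := mem_primePairs.1 ha
  refine (Finset.card_le_card (t := {a, a.swap}) fun b hb => ?_).trans Finset.card_le_two
  obtain ⟨hb, h⟩ := Finset.mem_filter.1 hb
  obtain ⟨-, hr, hs, -⟩ := mem_primePairs.1 hb
  rcases hp.dvd_mul.1 (h ▸ dvd_mul_right a.1 a.2) with h1 | h1
  · rw [Nat.prime_dvd_prime_iff_eq hp hr] at h1
    rw [← h1] at h
    have := Nat.eq_of_mul_eq_mul_left hp.pos h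
    simp [Prod.ext_iff, h1, this]
  · rw [Nat.prime_dvd_prime_iff_eq hp hs] at h1
    rw [← h1, mul_comm] at h
    have := Nat.eq_of_mul_eq_mul_right hp.pos h
    simp [Prod.ext_iff, h1, this]

open Classical in
lemma Sg_le_card_filter (g d : ℕ) (Z : ℝ) :
    Sg g d Z ≤ ((primePairs Z).filter fun a => IsRepBy g d (a.1 * a.2)).card := by
  rw [Sg, ← Set.ncard_coe_finset]
  refine Set.ncard_le_ncard ?_ (Finset.finite_toSet _)
  rintro ⟨p, q⟩ ⟨hp, hq, hne, h1, h2, h3, h4, u, v, hu, hv, hgcd, h⟩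
  refine Finset.mem_coe.2 (Finset.mem_filter.2
    ⟨mem_primePairs.2 ⟨⟨⟨h1, h2⟩, h3, h4⟩, hp, hq, hne⟩,
      u.natAbs, v.natAbs, Int.natAbs_pos.2 hu, Int.natAbs_pos.2 hv, ?_, ?_⟩)
  · rwa [← Nat.cast_mul, Int.gcd, Int.natAbs_natCast] at hgcd
  · zify
    rw [sq_abs, sq_abs]
    exact h

/-- Fix a prime `g ≥ 5`.  For every `ε > 0` there is `C = C(g, ε)` such that
for all `X ≥ 2` and all `Z` with `X^(1/(2g)) ≤ Z ≤ X`,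
`∑_{X ≤ d < 2X, d squarefree} S_g(d;Z)² ≤ C·X^ε·(Z²X^(1/2) + Z^(2g+4)·X^(-1))`. -/
theorem second_moment_Sg_bound (g : ℕ) (hg : g.Prime) (hg5 : 5 ≤ g)
    (ε : ℝ) (hε : 0 < ε) :
    ∃ C : ℝ, 0 < C ∧ ∀ X Z : ℝ, 2 ≤ X →
      X ^ ((1 : ℝ) / (2 * g)) ≤ Z → Z ≤ X →
      ∑ d ∈ (Finset.range (⌈2 * X⌉₊ + 1)).filter
          (fun d : ℕ => Squarefree d ∧ X ≤ (d : ℝ) ∧ (d : ℝ) < 2 * X),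
        (Sg g d Z : ℝ) ^ 2
      ≤ C * X ^ ε * (Z ^ 2 * X ^ ((1 : ℝ) / 2) + Z ^ (2 * g + 4) * X⁻¹) := by
  classical
  have hg0 : (0 : ℝ) < g := by exact_mod_cast hg.pos
  set δ : ℝ := ε / (4 * g) with hδ
  have hδ0 : 0 < δ := by positivity
  obtain ⟨K, hK, hdiv⟩ := exists_card_divisors_le_rpow hδ0
  refine ⟨4 ^ (g + 5) * (K * ((16 : ℝ) ^ (g + 1)) ^ δ), by positivity, fun X Z hX hXZ hZX => ?_⟩
  set D := (Finset.range (⌈2 * X⌉₊ + 1)).filter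
    (fun d : ℕ => Squarefree d ∧ X ≤ (d : ℝ) ∧ (d : ℝ) < 2 * X) with hD
  have hD' : ∀ d ∈ D, X ≤ d ∧ (d : ℝ) < 2 * X := fun d hd => (Finset.mem_filter.1 hd).2.2
  have hX0 : 0 < X := by linarith
  have hZ1 : 1 ≤ Z := (Real.one_le_rpow (by linarith) (by positivity)).trans hXZ
  set s : ℝ := √X with hs
  have hs0 : 0 < s := Real.sqrt_pos.2 hX0
  have hsX : s ^ 2 = X := Real.sq_sqrt hX0.le
  set y : ℝ := Z ^ g with hy
  have hy0 : 0 < y := by positivity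
  have hsy : s ≤ y := by
    have h1 : (X ^ ((1 : ℝ) / (2 * g))) ^ g ≤ Z ^ g := by gcongr
    rw [← Real.rpow_natCast, ← Real.rpow_mul hX0.le,
      show (1 : ℝ) / (2 * g) * g = 1 / 2 by field_simp, ← Real.sqrt_eq_rpow] at h1
    exact h1
  set V : ℝ := 2 ^ (g + 1) * (y / s) with hV
  have hV0 : 0 ≤ V := by positivity
  set M : ℝ := 4 * (4 * Z ^ 2) ^ g with hM
  have hMV : M = X * V ^ 2 := by
    have h1 : ((2 : ℝ) ^ (g + 1)) ^ 2 = 4 * 4 ^ g := by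
      rw [← pow_mul, mul_comm, pow_mul]; norm_num; ring
    rw [hM, hV, ← hsX, mul_pow (2 ^ (g + 1)), h1, div_pow, mul_pow, hy, ← pow_mul, ← pow_mul,
      mul_comm g]
    field_simp
  have hM1 : 1 ≤ M := by
    have : (1 : ℝ) ≤ (4 * Z ^ 2) ^ g := one_le_pow₀ (by nlinarith)
    linarith
  set B : ℝ := K * ((16 : ℝ) ^ (g + 1)) ^ δ * X ^ ε with hB
  have hB0 : 0 ≤ B := by positivity
  have hdivB : ∀ k : ℕ, k ≠ 0 → (k : ℝ) ≤ M * V ^ 2 → (k.divisors.card : ℝ) ≤ B := by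
    intro k hk hkM
    have h1 : M * V ^ 2 ≤ 16 ^ (g + 1) * X ^ (4 * g) := by
      have h2 : V ^ 2 ≤ M := by
        rw [hMV]; nlinarith [sq_nonneg V]
      have h3 : M ≤ 4 * (4 * X ^ 2) ^ g := by rw [hM]; gcongr
      have h4 : (4 * (4 * X ^ 2) ^ g) * (4 * (4 * X ^ 2) ^ g) = 16 ^ (g + 1) * X ^ (4 * g) := by
        rw [mul_mul_mul_comm, ← mul_pow, pow_mul, pow_succ' (16 : ℝ), mul_assoc (16 : ℝ), ← mul_pow,
          show (4 : ℝ) * X ^ 2 * (4 * X ^ 2) = 16 * X ^ 4 by ring]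
        norm_num
      rw [← h4]
      gcongr
      exact h2.trans h3
    calc (k.divisors.card : ℝ) ≤ K * (k : ℝ) ^ δ := hdiv k hk
      _ ≤ K * (16 ^ (g + 1) * X ^ (4 * g)) ^ δ := by gcongr; exact hkM.trans h1
      _ = B := by
        rw [hB, Real.mul_rpow (by positivity) (by positivity), ← Real.rpow_natCast X,
          ← Real.rpow_mul hX0.le, hδ, mul_assoc]
        congr 3
        push_cast
        field_simp
  have hrange : ∀ a ∈ primePairs Z, y ^ 2 ≤ ((a.1 * a.2 : ℕ) : ℝ) ^ g ∧
      4 * ((a.1 * a.2 : ℕ) : ℝ) ^ g ≤ M := by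
    intro a ha
    obtain ⟨⟨⟨h1, h2⟩, h3, h4⟩, -⟩ := mem_primePairs.1 ha
    rw [hy, hM, ← pow_mul, mul_comm, pow_mul]
    push_cast
    constructor
    · gcongr
      rw [sq]
      gcongr
    · have h5 : (a.1 : ℝ) * a.2 ≤ 4 * Z ^ 2 := by
        calc (a.1 : ℝ) * a.2 ≤ (2 * Z) * (2 * Z) := by gcongr
          _ = _ := by ring
      gcongr
  have hsqf : ∀ a ∈ primePairs Z, Squarefree (a.1 * a.2) := by
    intro a ha
    obtain ⟨-, hp, hq, hne⟩ := mem_primePairs.1 ha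
    exact (Nat.squarefree_mul ((Nat.coprime_primes hp hq).2 hne)).2
      ⟨hp.prime.squarefree, hq.prime.squarefree⟩
  have hmain := sum_sq_card_filter_le D (primePairs Z) (fun d a => IsRepBy g d (a.1 * a.2))
    (fun a => a.1 * a.2) 2 (A := V * (B * (8 * X / y + 1))) (B := V ^ 2 * B)
    (by positivity) (by positivity) (fun a ha => card_filter_mul_eq_le Z ha)
    (fun a ha => card_filter_isRepBy_le hX0 hV0 hy0 hB0 (hrange a ha).1
      ((hrange a ha).2.trans hMV.le) hD' fun n hn hnV => hdivB n hn (by nlinarith [sq_nonneg V]))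
    (fun a ha b hb hab => card_filter_isRepBy_and_le (hg.odd_of_ne_two (by omega)) (hsqf a ha)
      (hsqf b hb) hab hX0 hV0 hB0 (hrange a ha).2 (hrange b hb).2 hMV.le (fun d hd => (hD' d hd).1)
      hdivB)
  have hT := card_primePairs_le hZ1
  have hA : V * (8 * X / y + 1) = 2 ^ (g + 1) * (8 * s + y / s) := by
    rw [hV, ← hsX]; field_simp
  have hone : Z ^ 2 * (y / s) ≤ (Z ^ 2 * (y / s)) ^ 2 := by
    have h1 : 1 ≤ y / s := (one_le_div hs0).2 hsy
    have h2 : 1 ≤ Z ^ 2 * (y / s) := by nlinarith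
    nlinarith
  have hfin : (Z ^ 2 * (y / s)) ^ 2 = Z ^ (2 * g + 4) * X⁻¹ := by
    rw [← hsX, hy]; field_simp; ring
  calc ∑ d ∈ D, (Sg g d Z : ℝ) ^ 2
      ≤ ∑ d ∈ D, (((primePairs Z).filter fun a => IsRepBy g d (a.1 * a.2)).card : ℝ) ^ 2 := by
        gcongr with d hd
        exact Sg_le_card_filter g d Z
    _ ≤ _ := hmain
    _ ≤ (2 : ℕ) * (4 * Z ^ 2) * (V * (B * (8 * X / y + 1))) + (4 * Z ^ 2) ^ 2 * (V ^ 2 * B) := by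
        gcongr
    _ = B * (2 ^ (g + 1) * (64 * (Z ^ 2 * s) + 8 * (Z ^ 2 * (y / s)))
          + 2 ^ (g + 1) * 2 ^ (g + 1) * (16 * (Z ^ 2 * (y / s)) ^ 2)) := by
        linear_combination (8 * Z ^ 2 * B) * hA + (16 * Z ^ 4 * B) * congrArg (· ^ 2) hV
    _ ≤ B * (4 ^ (g + 5) * (Z ^ 2 * s + (Z ^ 2 * (y / s)) ^ 2)) := by
        gcongr
        have h1 : (2 : ℝ) ^ (g + 1) ≤ 4 ^ (g + 1) := by gcongr; norm_num
        have h2 : (2 : ℝ) ^ (g + 1) * 2 ^ (g + 1) = 4 ^ (g + 1) := by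
          rw [← mul_pow]; norm_num
        have h3 : (4 : ℝ) ^ (g + 5) = 256 * 4 ^ (g + 1) := by ring
        have h4 : 0 ≤ Z ^ 2 * s := by positivity
        rw [h2, h3]
        calc _ ≤ (4 : ℝ) ^ (g + 1) * (64 * (Z ^ 2 * s) + 8 * (Z ^ 2 * (y / s)) ^ 2)
              + 4 ^ (g + 1) * (16 * (Z ^ 2 * (y / s)) ^ 2) := by gcongr
          _ = 4 ^ (g + 1) * (64 * (Z ^ 2 * s) + 24 * (Z ^ 2 * (y / s)) ^ 2) := by ring
          _ ≤ 4 ^ (g + 1) * (256 * (Z ^ 2 * s) + 256 * (Z ^ 2 * (y / s)) ^ 2) := by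
            gcongr <;> norm_num
          _ = _ := by ring
    _ = _ := by
        rw [hfin, hB, hs, Real.sqrt_eq_rpow]; ring
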